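/- Let 1 ≤ a < n, set t = gcd(2n, a), and suppose 2n/t is odd, say 2n/t = 2k + 1. Then the edge ideal of the cubic circulant graph C_{2n}(a, n) satisfies: reg(I(C_{2n}(a, n))) = kt/2 + 1 if k is even, and reg(I(C_{2n}(a, n))) = (k + 1)t/2 + 1 if k is odd. -/

import Mathlib

/-- The faces of cardinality `m` of a simplicial complex, given as a finite
family of finite subsets of `Fin n`. -/
def cfaces {n : ℕ} (Δ : Finset (Finset (Fin n))) (m : ℕ) : Finset (Finset (Fin n)) :=
  Δ.filter (fun F => F.card = m)

/-- The coefficient of the face `G` in the simplicial boundary of the face `F`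
(with respect to the linear order on the vertices `Fin n`). -/
noncomputable def bcoeff (K : Type*) [Field K] {n : ℕ} (F G : Finset (Fin n)) : K :=
  ∑ v ∈ F, if F.erase v = G then (-1 : K) ^ (F.filter (fun w => w < v)).card else 0

/-- The simplicial boundary map from chains spanned by faces of cardinality `m+1`
to chains spanned by faces of cardinality `m` (so the augmentation map
corresponds to `m = 0`). -/
noncomputable def boundaryMap (K : Type*) [Field K] {n : ℕ}
    (Δ : Finset (Finset (Fin n))) (m : ℕ) :
    ({F // F ∈ cfaces Δ (m + 1)} → K) →ₗ[K] ({G // G ∈ cfaces Δ m} → K) :=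
  LinearMap.pi fun G => ∑ F : {F // F ∈ cfaces Δ (m + 1)}, bcoeff K F.1 G.1 • LinearMap.proj F

/-- The dimension over `K` of the `i`-th reduced simplicial homology of the
simplicial complex `Δ` (using the augmented chain complex, so that
`i = -1` is allowed). -/
noncomputable def reducedHomologyRank (K : Type*) [Field K] {n : ℕ}
    (Δ : Finset (Finset (Fin n))) (i : ℤ) : ℕ :=
  if i = -1 then
    Module.finrank K (({F // F ∈ cfaces Δ 0} → K) ⧸ LinearMap.range (boundaryMap K Δ 0))
  else if 0 ≤ i then
    Module.finrank K
      (↥(LinearMap.ker (boundaryMap K Δ i.toNat)) ⧸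
        Submodule.comap (LinearMap.ker (boundaryMap K Δ i.toNat)).subtype
          (LinearMap.range (boundaryMap K Δ (i.toNat + 1))))
  else 0

/-- The graded Betti numbers `β_{i,j}` of the Stanley–Reisner ideal of the
simplicial complex `Δ` over the field `K`, defined via Hochster's formula:
`β_{i,j} = ∑_{|W| = j} dim_K H̃_{j-i-2}(Δ_W; K)`. -/
noncomputable def bettiNumber (K : Type*) [Field K] {n : ℕ}
    (Δ : Finset (Finset (Fin n))) (i j : ℕ) : ℕ :=
  ∑ W ∈ Finset.powersetCard j (Finset.univ : Finset (Fin n)),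
    reducedHomologyRank K (Δ.filter (fun F => F ⊆ W)) ((j : ℤ) - (i : ℤ) - 2)

/-- The Castelnuovo–Mumford regularity `reg(I) = max { j - i | β_{i,j}(I) ≠ 0 }`
of the Stanley–Reisner ideal of `Δ` over `K`. -/
noncomputable def regSR (K : Type*) [Field K] {n : ℕ} (Δ : Finset (Finset (Fin n))) : ℕ :=
  sSup {d : ℕ | ∃ i j : ℕ, bettiNumber K Δ i j ≠ 0 ∧ (j : ℤ) - (i : ℤ) = d}

/-- The projective dimension `pd(I) = max { i | β_{i,j}(I) ≠ 0 for some j }`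
of the Stanley–Reisner ideal of `Δ` over `K`. -/
noncomputable def pdSR (K : Type*) [Field K] {n : ℕ} (Δ : Finset (Finset (Fin n))) : ℕ :=
  sSup {i : ℕ | ∃ j : ℕ, bettiNumber K Δ i j ≠ 0}

/-- The reduced Euler characteristic `χ̃(Δ) = ∑_{F ∈ Δ} (-1)^{|F| - 1}`
of a simplicial complex `Δ` (the alternating sum of the `f`-vector). -/
def eulerCharSR {n : ℕ} (Δ : Finset (Finset (Fin n))) : ℤ :=
  ∑ F ∈ Δ, (-1 : ℤ) ^ (F.card + 1)

/-- The circulant graph `C_n(S)`: the graph on the vertex set `ZMod n`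
(identified with `{x_1, …, x_n}`) in which `x` and `y` are adjacent if and only
if they differ by `±s (mod n)` for some `s ∈ S`. -/
def circulant (n : ℕ) (S : Set ℕ) : SimpleGraph (ZMod n) :=
  SimpleGraph.fromRel (fun x y => ∃ s ∈ S, y - x = (s : ZMod n))

/-- A graph is chordal if it has no induced cycle of length `m ≥ 4`.  Here an
induced `m`-cycle is an injection of the cycle `C_m = C_m(1)` whose image
induces exactly the cycle's adjacency. -/
def IsChordal {V : Type*} (G : SimpleGraph V) : Prop :=
  ∀ m : ℕ, 4 ≤ m → ¬ ∃ f : ZMod m → V, Function.Injective f ∧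
    ∀ a b : ZMod m, G.Adj (f a) (f b) ↔ (circulant m {1}).Adj a b

/-- A graph is claw-free if it has no induced subgraph isomorphic to the claw
`K_{1,3}`, i.e. there is no vertex adjacent to three pairwise non-adjacent
vertices. -/
def ClawFree {V : Type*} (G : SimpleGraph V) : Prop :=
  ¬ ∃ c x y z : V, x ≠ y ∧ x ≠ z ∧ y ≠ z ∧
    G.Adj c x ∧ G.Adj c y ∧ G.Adj c z ∧ ¬ G.Adj x y ∧ ¬ G.Adj x z ∧ ¬ G.Adj y z

open Classical in
/-- The independence complex `Ind(G)` of a finite simple graph `G`, recorded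
as a simplicial complex on `Fin (card V)` via a fixed identification of the
vertices with `Fin (card V)`.  It is the Stanley–Reisner complex of the edge
ideal `I(G)`. -/
noncomputable def indComplex {V : Type*} [Fintype V] (G : SimpleGraph V) :
    Finset (Finset (Fin (Fintype.card V))) :=
  Finset.univ.filter (fun F : Finset (Fin (Fintype.card V)) =>
    ∀ u ∈ F, ∀ v ∈ F,
      ¬ G.Adj ((Fintype.equivFin V).symm u) ((Fintype.equivFin V).symm v))

/-- The Castelnuovo–Mumford regularity `reg(I(G))` of the edge ideal of the
finite simple graph `G` over the field `K`, computed (via Hochster's formula)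
from the independence complex of `G`. -/
noncomputable def regEdgeIdeal (K : Type*) [Field K] {V : Type*} [Fintype V]
    (G : SimpleGraph V) : ℕ :=
  regSR K (indComplex G)

/-- The projective dimension `pd(I(G))` of the edge ideal of the finite simple
graph `G` over the field `K`, computed (via Hochster's formula) from the
independence complex of `G`. -/
noncomputable def pdEdgeIdeal (K : Type*) [Field K] {V : Type*} [Fintype V]
    (G : SimpleGraph V) : ℕ :=
  pdSR K (indComplex G)

section ExteriorOperators

variable {K : Type*} [Field K] {N : ℕ}

/-- The sign attached to inserting the vertex `x` into the face `F`. -/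
def insertSign (K : Type*) [Field K] {N : ℕ} (x : Fin N) (F : Finset (Fin N)) : K :=
  (-1) ^ (F.filter (fun w => w < x)).card

/-- Contraction of a chain by the vertex `x`. -/
def contractVertex (x : Fin N) : (Finset (Fin N) → K) →ₗ[K] (Finset (Fin N) → K) where
  toFun c F := if x ∈ F then 0 else insertSign K x F * c (insert x F)
  map_add' c d := by ext F; by_cases h : x ∈ F <;> simp [h, mul_add]
  map_smul' a c := by ext F; by_cases h : x ∈ F <;> simp [h]; ring

/-- The cone of a chain with apex the vertex `x`. -/
def coneVertex (x : Fin N) : (Finset (Fin N) → K) →ₗ[K] (Finset (Fin N) → K) where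
  toFun c F := if x ∈ F then insertSign K x F * c (F.erase x) else 0
  map_add' c d := by ext F; by_cases h : x ∈ F <;> simp [h, mul_add]
  map_smul' a c := by ext F; by_cases h : x ∈ F <;> simp [h]; ring

/-- The simplicial boundary on chains of the full simplex. -/
def fullBoundary : (Finset (Fin N) → K) →ₗ[K] (Finset (Fin N) → K) :=
  ∑ x, contractVertex x

lemma contractVertex_apply (x : Fin N) (c : Finset (Fin N) → K) (F : Finset (Fin N)) :
    contractVertex x c F = if x ∈ F then 0 else insertSign K x F * c (insert x F) := rfl

lemma coneVertex_apply (x : Fin N) (c : Finset (Fin N) → K) (F : Finset (Fin N)) :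
    coneVertex x c F = if x ∈ F then insertSign K x F * c (F.erase x) else 0 := rfl

lemma fullBoundary_apply (c : Finset (Fin N) → K) :
    fullBoundary c = ∑ x, contractVertex x c := by
  simp [fullBoundary]

lemma insertSign_mul_self (x : Fin N) (F : Finset (Fin N)) :
    insertSign K x F * insertSign K x F = 1 := by
  simp [insertSign, ← mul_pow]

lemma insertSign_erase_self (x : Fin N) (F : Finset (Fin N)) :
    insertSign K x (F.erase x) = insertSign K x F := by
  unfold insertSign
  congr 2
  ext w
  simp only [Finset.mem_filter, Finset.mem_erase]
  exact ⟨fun h => ⟨h.1.2, h.2⟩, fun h => ⟨⟨h.2.ne, h.1⟩, h.2⟩⟩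

lemma insertSign_insert_self (x : Fin N) (F : Finset (Fin N)) :
    insertSign K x (insert x F) = insertSign K x F := by
  unfold insertSign
  congr 2
  ext w
  simp only [Finset.mem_filter, Finset.mem_insert]
  exact ⟨fun h => ⟨h.1.resolve_left h.2.ne, h.2⟩, fun h => ⟨Or.inr h.1, h.2⟩⟩

lemma insertSign_insert {x v : Fin N} {F : Finset (Fin N)} (hv : v ∉ F) :
    insertSign K x (insert v F) = (if v < x then -1 else 1) * insertSign K x F := by
  unfold insertSign
  rw [Finset.filter_insert]
  split_ifs with h
  · rw [Finset.card_insert_of_notMem (by simp [hv]), pow_succ]; ring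
  · simp

lemma contractVertex_comm {x v : Fin N} (c : Finset (Fin N) → K) :
    contractVertex x (contractVertex v c) = - contractVertex v (contractVertex x c) := by
  ext F
  rcases eq_or_ne x v with rfl | hxv
  · simp [contractVertex_apply]
  simp only [contractVertex_apply, Pi.neg_apply, Finset.mem_insert]
  by_cases hx : x ∈ F
  · simp [hx]
  by_cases hv : v ∈ F
  · simp [hv]
  simp only [hx, hv, hxv, hxv.symm, or_self, if_false]
  rw [insertSign_insert hx, insertSign_insert hv, Finset.insert_comm]
  rcases lt_or_gt_of_ne hxv with h | h
  · simp only [h, h.not_gt, if_true, if_false]; ring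
  · simp only [h, h.not_gt, if_true, if_false]; ring

lemma contractVertex_coneVertex {x v : Fin N} (hxv : v ≠ x) (c : Finset (Fin N) → K) :
    contractVertex v (coneVertex x c) = - coneVertex x (contractVertex v c) := by
  ext F
  simp only [contractVertex_apply, coneVertex_apply, Pi.neg_apply, Finset.mem_insert,
    Finset.mem_erase]
  by_cases hx : x ∈ F
  swap
  · simp [hx, hxv.symm]
  by_cases hv : v ∈ F
  · simp [hv, hxv]
  simp only [hx, hv, or_true, and_false, if_true, if_false]
  have h1 : (insert v F).erase x = insert v (F.erase x) := by
    rw [Finset.erase_insert_of_ne hxv]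
  have h2 : insertSign K v F = (if x < v then -1 else 1) * insertSign K v (F.erase x) := by
    conv_lhs => rw [← Finset.insert_erase hx]
    exact insertSign_insert (by simp)
  rw [h1, h2, insertSign_insert hv]
  rcases lt_or_gt_of_ne hxv with h | h
  · simp only [h, h.not_gt, if_true, if_false]; ring
  · simp only [h, h.not_gt, if_true, if_false]; ring

lemma coneVertex_contractVertex_apply (x : Fin N) (c : Finset (Fin N) → K)
    (F : Finset (Fin N)) :
    coneVertex x (contractVertex x c) F = if x ∈ F then c F else 0 := by
  simp only [contractVertex_apply, coneVertex_apply]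
  by_cases hx : x ∈ F
  · simp [hx, insertSign_erase_self, ← mul_assoc, insertSign_mul_self]
  · simp [hx]

lemma contractVertex_coneVertex_self (x : Fin N) (c : Finset (Fin N) → K) :
    contractVertex x (coneVertex x c) = c - coneVertex x (contractVertex x c) := by
  ext F
  rw [Pi.sub_apply, coneVertex_contractVertex_apply]
  simp only [contractVertex_apply, coneVertex_apply]
  by_cases hx : x ∈ F
  · simp [hx]
  · simp [hx, insertSign_insert_self, ← mul_assoc, insertSign_mul_self]

lemma fullBoundary_coneVertex (x : Fin N) (c : Finset (Fin N) → K) :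
    fullBoundary (coneVertex x c) = c - coneVertex x (fullBoundary c) := by
  rw [fullBoundary_apply, fullBoundary_apply, map_sum,
    ← Finset.add_sum_erase _ _ (Finset.mem_univ x),
    ← Finset.add_sum_erase _ (fun i => coneVertex x (contractVertex i c)) (Finset.mem_univ x),
    contractVertex_coneVertex_self,
    Finset.sum_congr rfl (fun v hv => contractVertex_coneVertex (Finset.ne_of_mem_erase hv) c),
    Finset.sum_neg_distrib]
  abel

lemma contractVertex_fullBoundary (x : Fin N) (c : Finset (Fin N) → K) :
    contractVertex x (fullBoundary c) = - fullBoundary (contractVertex x c) := by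
  rw [fullBoundary_apply, fullBoundary_apply, map_sum, ← Finset.sum_neg_distrib]
  exact Finset.sum_congr rfl fun v _ => contractVertex_comm c

end ExteriorOperators

section Chains

variable {K : Type*} [Field K] {N : ℕ}

/-- The chain `c` is a combination of faces of cardinality `m` satisfying `S`. -/
def IsChainOn (S : Finset (Fin N) → Prop) (m : ℕ) (c : Finset (Fin N) → K) : Prop :=
  ∀ F, c F ≠ 0 → S F ∧ F.card = m

/-- Every cycle on faces of cardinality `m` satisfying `S` bounds. -/
def Acyclic (K : Type*) [Field K] {N : ℕ} (S : Finset (Fin N) → Prop) (m : ℕ) : Prop :=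
  ∀ z : Finset (Fin N) → K, IsChainOn S m z → fullBoundary z = 0 →
    ∃ u, IsChainOn S (m + 1) u ∧ fullBoundary u = z

/-- `F` is an independent set of `G` contained in `W`. -/
def IndepIn (G : SimpleGraph (Fin N)) (W : Set (Fin N)) (F : Finset (Fin N)) : Prop :=
  ↑F ⊆ W ∧ ∀ u ∈ F, ∀ v ∈ F, ¬ G.Adj u v

lemma IsChainOn.add {S : Finset (Fin N) → Prop} {m : ℕ} {c d : Finset (Fin N) → K}
    (hc : IsChainOn S m c) (hd : IsChainOn S m d) : IsChainOn S m (c + d) := by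
  intro F hF
  by_cases h : c F = 0
  · exact hd F (fun h' => hF (by simp [h, h']))
  · exact hc F h

lemma IsChainOn.neg {S : Finset (Fin N) → Prop} {m : ℕ} {c : Finset (Fin N) → K}
    (hc : IsChainOn S m c) : IsChainOn S m (-c) :=
  fun F hF => hc F (by simpa using hF)

lemma IsChainOn.sub {S : Finset (Fin N) → Prop} {m : ℕ} {c d : Finset (Fin N) → K}
    (hc : IsChainOn S m c) (hd : IsChainOn S m d) : IsChainOn S m (c - d) := by
  rw [sub_eq_add_neg]; exact hc.add hd.neg

lemma IsChainOn.mono {S T : Finset (Fin N) → Prop} {m : ℕ} {c : Finset (Fin N) → K}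
    (hc : IsChainOn S m c) (h : ∀ F, S F → T F) : IsChainOn T m c :=
  fun F hF => ⟨h F (hc F hF).1, (hc F hF).2⟩

lemma IndepIn.mono {G : SimpleGraph (Fin N)} {W W' : Set (Fin N)} (h : W ⊆ W')
    (F : Finset (Fin N)) (hF : IndepIn G W F) : IndepIn G W' F :=
  ⟨hF.1.trans h, hF.2⟩

/-- The vertices of `W` other than `x` and not related to `x`. -/
def linkSet {V : Type*} (A : V → V → Prop) (W : Set V) (x : V) : Set V :=
  {y | y ∈ W ∧ y ≠ x ∧ ¬ A x y}

lemma IsChainOn.coneVertex {G : SimpleGraph (Fin N)} {W : Set (Fin N)} {x : Fin N} (hx : x ∈ W)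
    {m : ℕ} {c : Finset (Fin N) → K} (hc : IsChainOn (IndepIn G (linkSet G.Adj W x)) m c) :
    IsChainOn (IndepIn G W) (m + 1) (coneVertex x c) := by
  intro F hF
  rw [coneVertex_apply] at hF
  split_ifs at hF with hxF
  swap
  · exact absurd rfl hF
  obtain ⟨⟨h1, h2⟩, h3⟩ := hc _ (right_ne_zero_of_mul hF)
  have h4 : ∀ v ∈ F, v = x ∨ (v ∈ F.erase x ∧ v ∈ linkSet G.Adj W x) := by
    intro v hv
    by_cases h : v = x
    · exact Or.inl h
    · have : v ∈ F.erase x := Finset.mem_erase.2 ⟨h, hv⟩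
      exact Or.inr ⟨this, h1 this⟩
  refine ⟨⟨?_, ?_⟩, ?_⟩
  · intro v hv
    rcases h4 v hv with rfl | h
    · exact hx
    · exact h.2.1
  · intro u hu v hv
    rcases h4 u hu with rfl | hu' <;> rcases h4 v hv with rfl | hv'
    · exact G.loopless.irrefl _
    · exact hv'.2.2.2
    · exact fun h => hu'.2.2.2 h.symm
    · exact h2 u hu'.1 v hv'.1
  · rw [← h3, Finset.card_erase_add_one hxF]

lemma IsChainOn.contractVertex {G : SimpleGraph (Fin N)} {W : Set (Fin N)} {x : Fin N}
    {m : ℕ} {c : Finset (Fin N) → K} (hc : IsChainOn (IndepIn G W) (m + 1) c) :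
    IsChainOn (IndepIn G (linkSet G.Adj W x)) m (contractVertex x c) := by
  intro F hF
  rw [contractVertex_apply] at hF
  split_ifs at hF with hxF
  · exact absurd rfl hF
  obtain ⟨⟨h1, h2⟩, h3⟩ := hc _ (right_ne_zero_of_mul hF)
  refine ⟨⟨fun v hv => ⟨h1 (by simp at hv; simp [hv]), ?_, h2 _ (by simp) _
      (by simp at hv; simp [hv])⟩,
    fun u hu v hv => h2 u (by simp [hu]) v (by simp [hv])⟩, ?_⟩
  · rintro rfl; exact hxF (by simpa using hv)
  · rw [Finset.card_insert_of_notMem hxF] at h3; omega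

lemma IsChainOn.sub_cone {G : SimpleGraph (Fin N)} {W : Set (Fin N)} (x : Fin N)
    {m : ℕ} {c : Finset (Fin N) → K} (hc : IsChainOn (IndepIn G W) m c) :
    IsChainOn (IndepIn G (W \ {x})) m (c - _root_.coneVertex x (_root_.contractVertex x c)) := by
  intro F hF
  rw [Pi.sub_apply, coneVertex_contractVertex_apply] at hF
  split_ifs at hF with hxF
  · simp at hF
  obtain ⟨⟨h1, h2⟩, h3⟩ := hc F (by simpa using hF)
  exact ⟨⟨fun v hv => ⟨h1 hv, by rintro rfl; exact hxF (by simpa using hv)⟩, h2⟩, h3⟩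

lemma contractVertex_eq_zero {G : SimpleGraph (Fin N)} {W : Set (Fin N)} {x : Fin N} (hx : x ∉ W)
    {m : ℕ} {c : Finset (Fin N) → K} (hc : IsChainOn (IndepIn G W) m c) :
    contractVertex x c = 0 := by
  ext F
  rw [contractVertex_apply]
  split_ifs with hxF
  · rfl
  · by_contra h
    exact hx ((hc _ (right_ne_zero_of_mul h)).1.1 (by simp))

lemma linkSet_subset {V : Type*} (A : V → V → Prop) (W : Set V) (x : V) :
    linkSet A W x ⊆ W \ {x} := fun _ hy => ⟨hy.1, hy.2.1⟩

lemma acyclic_of_isolated {G : SimpleGraph (Fin N)} {W : Set (Fin N)} {x : Fin N} (hx : x ∈ W)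
    (h : ∀ y ∈ W, ¬ G.Adj x y) (m : ℕ) : Acyclic K (IndepIn G W) m := by
  intro z hz hbz
  refine ⟨coneVertex x (z - coneVertex x (contractVertex x z)), ?_, ?_⟩
  · refine IsChainOn.coneVertex hx ((hz.sub_cone x).mono (IndepIn.mono ?_))
    exact fun y hy => ⟨hy.1, hy.2, h y hy.1⟩
  · have : coneVertex x (coneVertex x (contractVertex x z)) = 0 := by
      ext F
      simp [coneVertex_apply]
    rw [map_sub, this, sub_zero, fullBoundary_coneVertex, hbz, map_zero, sub_zero]

lemma acyclic_step {G : SimpleGraph (Fin N)} {W : Set (Fin N)} (x : Fin N) {m : ℕ}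
    (h1 : Acyclic K (IndepIn G (W \ {x})) (m + 1))
    (h2 : Acyclic K (IndepIn G (linkSet G.Adj W x)) m) :
    Acyclic K (IndepIn G W) (m + 1) := by
  by_cases hx : x ∈ W
  swap
  · rwa [Set.sdiff_singleton_eq_self hx] at h1
  intro z hz hbz
  have hbz' : fullBoundary (contractVertex x z) = 0 := by
    rw [← neg_eq_zero, ← contractVertex_fullBoundary, hbz, map_zero]
  obtain ⟨w, hw, hbw⟩ := h2 _ hz.contractVertex hbz'
  obtain ⟨u, hu, hbu⟩ := h1 (z - coneVertex x (contractVertex x z) + w)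
    ((hz.sub_cone x).add (hw.mono (IndepIn.mono (linkSet_subset _ _ _)))) (by
      rw [map_add, map_sub, fullBoundary_coneVertex, hbz, hbz', hbw]; simp)
  refine ⟨u - coneVertex x w,
    (hu.mono (IndepIn.mono Set.sdiff_subset)).sub (IsChainOn.coneVertex hx hw), ?_⟩
  rw [map_sub, fullBoundary_coneVertex, hbu, hbw]
  abel

lemma acyclic_zero_of_subset {G : SimpleGraph (Fin N)} {W W' : Set (Fin N)} (h : W' ⊆ W)
    (h1 : Acyclic K (IndepIn G W') 0) : Acyclic K (IndepIn G W) 0 := by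
  intro z hz hbz
  obtain ⟨u, hu, hbu⟩ := h1 z (fun F hF => by
    obtain ⟨-, h3⟩ := hz F hF
    obtain rfl := Finset.card_eq_zero.1 h3
    simp [IndepIn]) hbz
  exact ⟨u, hu.mono (IndepIn.mono h), hbu⟩

lemma not_acyclic_fold {G : SimpleGraph (Fin N)} {W : Set (Fin N)} (x : Fin N) {m : ℕ}
    (h1 : ¬ Acyclic K (IndepIn G (W \ {x})) m)
    (h2 : Acyclic K (IndepIn G (linkSet G.Adj W x)) m) :
    ¬ Acyclic K (IndepIn G W) m := by
  intro h
  refine h1 fun z hz hbz => ?_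
  obtain ⟨u, hu, hbu⟩ := h z (hz.mono (IndepIn.mono Set.sdiff_subset)) hbz
  have hb : fullBoundary (contractVertex x u) = 0 := by
    rw [← neg_eq_zero, ← contractVertex_fullBoundary, hbu,
      contractVertex_eq_zero (fun h => h.2 rfl) hz]
  obtain ⟨w, hw, hbw⟩ := h2 _ hu.contractVertex hb
  refine ⟨u - coneVertex x (contractVertex x u) + w,
    (hu.sub_cone x).add (hw.mono (IndepIn.mono (linkSet_subset _ _ _))), ?_⟩
  rw [map_add, map_sub, fullBoundary_coneVertex, hbu, hbw, hb]
  simp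

lemma not_acyclic_suspension {G : SimpleGraph (Fin N)} {W : Set (Fin N)} {x : Fin N}
    (hx : x ∈ W) {m : ℕ}
    (h1 : ¬ Acyclic K (IndepIn G (linkSet G.Adj W x)) m)
    (h2 : Acyclic K (IndepIn G (W \ {x})) m) :
    ¬ Acyclic K (IndepIn G W) (m + 1) := by
  intro h
  refine h1 fun z hz hbz => ?_
  obtain ⟨w, hw, hbw⟩ := h2 z (hz.mono (IndepIn.mono (linkSet_subset _ _ _))) hbz
  obtain ⟨u, hu, hbu⟩ := h (coneVertex x z - w)
    ((IsChainOn.coneVertex hx hz).sub (hw.mono (IndepIn.mono Set.sdiff_subset))) (by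
      rw [map_sub, fullBoundary_coneVertex, hbz, hbw]; simp)
  refine ⟨-contractVertex x u, hu.contractVertex.neg, ?_⟩
  rw [map_neg, ← contractVertex_fullBoundary, hbu, map_sub, contractVertex_coneVertex_self,
    contractVertex_eq_zero (fun h => h.2.1 rfl) hz,
    contractVertex_eq_zero (fun h => h.2 rfl) hw]
  simp

end Chains

section Derivations

/-- `RegBound A W r` records a recursive proof that independence complexes of induced subgraphs
of `W` have no homology in dimensions `≥ r`. -/
inductive RegBound {V : Type*} (A : V → V → Prop) : Set V → ℕ → Prop
  | empty (r : ℕ) : RegBound A ∅ r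
  | isolated {W : Set V} {r : ℕ} (x : V) :
      (∀ y ∈ W, ¬ A x y) → RegBound A (W \ {x}) r → RegBound A W r
  | step {W : Set V} {r : ℕ} (x : V) :
      RegBound A (W \ {x}) (r + 1) → RegBound A (linkSet A W x) r → RegBound A W (r + 1)

/-- `TrivialHomology A W` records a recursive proof that the independence complex on `W`
is acyclic. -/
inductive TrivialHomology {V : Type*} (A : V → V → Prop) : Set V → Prop
  | isolated {W : Set V} (x : V) : x ∈ W → (∀ y ∈ W, ¬ A x y) → TrivialHomology A W
  | step {W : Set V} (x : V) :
      TrivialHomology A (W \ {x}) → TrivialHomology A (linkSet A W x) → TrivialHomology A W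

/-- `SphereHomology A W p` records a recursive proof that the independence complex on `W`
has nonzero homology in dimension `p - 1`. -/
inductive SphereHomology {V : Type*} (A : V → V → Prop) : Set V → ℕ → Prop
  | empty : SphereHomology A ∅ 0
  | fold {W : Set V} {p : ℕ} (x : V) :
      SphereHomology A (W \ {x}) p → TrivialHomology A (linkSet A W x) → SphereHomology A W p
  | suspension {W : Set V} {p : ℕ} (x : V) : x ∈ W →
      SphereHomology A (linkSet A W x) p → TrivialHomology A (W \ {x}) →
      SphereHomology A W (p + 1)

variable {V V' : Type*} {A : V → V → Prop} {B : V' → V' → Prop}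

lemma linkSet_mono {W W' : Set V} (h : W' ⊆ W) (x : V) : linkSet A W' x ⊆ linkSet A W x :=
  fun _ hy => ⟨h hy.1, hy.2⟩

lemma RegBound.mono {W : Set V} {r : ℕ} (h : RegBound A W r) :
    ∀ {W' : Set V} {r' : ℕ}, W' ⊆ W → r ≤ r' → RegBound A W' r' := by
  induction h with
  | empty r =>
    intro W' r' hW _
    rw [Set.subset_empty_iff.1 hW]
    exact .empty _
  | isolated x hx _ ih =>
    intro W' r' hW hr
    exact .isolated x (fun y hy => hx y (hW hy)) (ih (Set.sdiff_subset_sdiff_left hW) hr)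
  | step x _ _ ih1 ih2 =>
    intro W' r' hW hr
    obtain ⟨s, rfl⟩ : ∃ s, r' = s + 1 := ⟨r' - 1, by omega⟩
    exact .step x (ih1 (Set.sdiff_subset_sdiff_left hW) hr) (ih2 (linkSet_mono hW x) (by omega))

/-- The map `f` is an induced embedding on `W`, and its image is disjoint from and unrelated
to `R`. -/
structure EmbedsAwayFrom (A : V → V → Prop) (B : V' → V' → Prop) (f : V → V') (W : Set V)
    (R : Set V') : Prop where
  inj : Set.InjOn f W
  rel : ∀ x ∈ W, ∀ y ∈ W, B (f x) (f y) ↔ A x y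
  disj : ∀ x ∈ W, ∀ y ∈ R, y ≠ f x
  unrel : ∀ x ∈ W, ∀ y ∈ R, ¬ B (f x) y

lemma EmbedsAwayFrom.mono {f : V → V'} {W W' : Set V} {R : Set V'}
    (h : EmbedsAwayFrom A B f W R) (hW : W' ⊆ W) : EmbedsAwayFrom A B f W' R :=
  ⟨h.inj.mono hW, fun x hx y hy => h.rel x (hW hx) y (hW hy),
    fun x hx => h.disj x (hW hx), fun x hx => h.unrel x (hW hx)⟩

lemma EmbedsAwayFrom.image_diff {f : V → V'} {W : Set V} {R : Set V'}
    (h : EmbedsAwayFrom A B f W R) {x : V} (hx : x ∈ W) :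
    (f '' W ∪ R) \ {f x} = f '' (W \ {x}) ∪ R := by
  ext y
  constructor
  · rintro ⟨⟨w, hw, rfl⟩ | hy, hne⟩
    · exact Or.inl ⟨w, ⟨hw, fun e => hne (by rw [Set.mem_singleton_iff.1 e]; rfl)⟩, rfl⟩
    · exact Or.inr hy
  · rintro (⟨w, ⟨hw, hne⟩, rfl⟩ | hy)
    · exact ⟨Or.inl ⟨w, hw, rfl⟩, fun e => hne (h.inj hw hx e)⟩
    · exact ⟨Or.inr hy, h.disj x hx y hy⟩

lemma EmbedsAwayFrom.image_linkSet {f : V → V'} {W : Set V} {R : Set V'}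
    (h : EmbedsAwayFrom A B f W R) {x : V} (hx : x ∈ W) :
    linkSet B (f '' W ∪ R) (f x) = f '' (linkSet A W x) ∪ R := by
  ext y
  constructor
  · rintro ⟨⟨w, hw, rfl⟩ | hy, hne, hB⟩
    · exact Or.inl ⟨w, ⟨hw, fun e => hne (by rw [e]), fun hA => hB ((h.rel x hx w hw).2 hA)⟩, rfl⟩
    · exact Or.inr hy
  · rintro (⟨w, ⟨hw, hne, hA⟩, rfl⟩ | hy)
    · exact ⟨Or.inl ⟨w, hw, rfl⟩, fun e => hne (h.inj hw hx e),
        fun hB => hA ((h.rel x hx w hw).1 hB)⟩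
    · exact ⟨Or.inr hy, h.disj x hx y hy, h.unrel x hx y hy⟩

lemma EmbedsAwayFrom.isolated {f : V → V'} {W : Set V} {R : Set V'}
    (h : EmbedsAwayFrom A B f W R) {x : V} (hx : x ∈ W) (hA : ∀ y ∈ W, ¬ A x y) :
    ∀ y ∈ f '' W ∪ R, ¬ B (f x) y := by
  rintro y (⟨w, hw, rfl⟩ | hy)
  · exact fun hB => hA w hw ((h.rel x hx w hw).1 hB)
  · exact h.unrel x hx y hy

lemma RegBound.union {W : Set V} {r : ℕ} (h : RegBound A W r) {f : V → V'} {R : Set V'} {q : ℕ}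
    (hR : RegBound B R q) : EmbedsAwayFrom A B f W R → RegBound B (f '' W ∪ R) (r + q) := by
  induction h with
  | empty r => exact fun _ => hR.mono (by simp) (by omega)
  | @isolated W r x hA _ ih =>
    intro hf
    by_cases hx : x ∈ W
    · exact .isolated (f x) (hf.isolated hx hA)
        (hf.image_diff hx ▸ ih (hf.mono Set.sdiff_subset))
    · rw [Set.sdiff_singleton_eq_self hx] at ih
      exact ih hf
  | @step W r x _ _ ih1 ih2 =>
    intro hf
    by_cases hx : x ∈ W
    · rw [Nat.add_right_comm] at ih1 ⊢
      exact .step (f x) (hf.image_diff hx ▸ ih1 (hf.mono Set.sdiff_subset))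
        (hf.image_linkSet hx ▸ ih2 (hf.mono ((linkSet_subset A W x).trans Set.sdiff_subset)))
    · rw [Set.sdiff_singleton_eq_self hx] at ih1
      exact ih1 hf

lemma TrivialHomology.union {W : Set V} (h : TrivialHomology A W) {f : V → V'} {R : Set V'} :
    EmbedsAwayFrom A B f W R → TrivialHomology B (f '' W ∪ R) := by
  induction h with
  | isolated x hx hA =>
    exact fun hf => .isolated (f x) (Or.inl ⟨x, hx, rfl⟩) (hf.isolated hx hA)
  | @step W x _ _ ih1 ih2 =>
    intro hf
    by_cases hx : x ∈ W
    · exact .step (f x) (hf.image_diff hx ▸ ih1 (hf.mono Set.sdiff_subset))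
        (hf.image_linkSet hx ▸ ih2 (hf.mono ((linkSet_subset A W x).trans Set.sdiff_subset)))
    · rw [Set.sdiff_singleton_eq_self hx] at ih1
      exact ih1 hf

lemma SphereHomology.union {W : Set V} {p : ℕ} (h : SphereHomology A W p) {f : V → V'}
    {R : Set V'} {q : ℕ} (hR : SphereHomology B R q) :
    EmbedsAwayFrom A B f W R → SphereHomology B (f '' W ∪ R) (p + q) := by
  induction h with
  | empty => exact fun _ => by simpa using hR
  | @fold W p x _ h2 ih1 =>
    intro hf
    by_cases hx : x ∈ W
    · refine .fold (f x) (hf.image_diff hx ▸ ih1 (hf.mono Set.sdiff_subset)) ?_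
      rw [hf.image_linkSet hx]
      exact h2.union (hf.mono ((linkSet_subset A W x).trans Set.sdiff_subset))
    · rw [Set.sdiff_singleton_eq_self hx] at ih1
      exact ih1 hf
  | @suspension W p x hx _ h2 ih1 =>
    intro hf
    rw [Nat.add_right_comm]
    refine .suspension (f x) (Or.inl ⟨x, hx, rfl⟩)
      (hf.image_linkSet hx ▸ ih1 (hf.mono ((linkSet_subset A W x).trans Set.sdiff_subset))) ?_
    rw [hf.image_diff hx]
    exact h2.union (hf.mono Set.sdiff_subset)

/-- A family of induced embeddings of `W` with disjoint, pairwise unrelated images. -/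
structure EmbeddedCopies (A : V → V → Prop) (B : V' → V' → Prop) (f : ℕ → V → V') (W : Set V)
    (s : ℕ) : Prop where
  inj : ∀ i < s, ∀ j < s, ∀ x ∈ W, ∀ y ∈ W, f i x = f j y → i = j ∧ x = y
  rel : ∀ i < s, ∀ j < s, ∀ x ∈ W, ∀ y ∈ W, B (f i x) (f j y) ↔ i = j ∧ A x y

lemma EmbeddedCopies.mono {f : ℕ → V → V'} {W W' : Set V} {s s' : ℕ}
    (h : EmbeddedCopies A B f W s) (hW : W' ⊆ W) (hs : s' ≤ s) : EmbeddedCopies A B f W' s' :=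
  ⟨fun i hi j hj x hx y hy => h.inj i (by omega) j (by omega) x (hW hx) y (hW hy),
    fun i hi j hj x hx y hy => h.rel i (by omega) j (by omega) x (hW hx) y (hW hy)⟩

/-- The union of the first `s` copies of `W`. -/
def copies (f : ℕ → V → V') (W : Set V) (s : ℕ) : Set V' := {y | ∃ i < s, ∃ x ∈ W, f i x = y}

lemma copies_zero (f : ℕ → V → V') (W : Set V) : copies f W 0 = ∅ := by
  simp [copies]

lemma copies_succ (f : ℕ → V → V') (W : Set V) (s : ℕ) :
    copies f W (s + 1) = f s '' W ∪ copies f W s := by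
  ext y
  constructor
  · rintro ⟨i, hi, x, hx, rfl⟩
    rcases Nat.lt_succ_iff_lt_or_eq.1 hi with hi | rfl
    · exact Or.inr ⟨i, hi, x, hx, rfl⟩
    · exact Or.inl ⟨x, hx, rfl⟩
  · rintro (⟨x, hx, rfl⟩ | ⟨i, hi, x, hx, rfl⟩)
    · exact ⟨s, by omega, x, hx, rfl⟩
    · exact ⟨i, by omega, x, hx, rfl⟩

lemma EmbeddedCopies.embedsAwayFrom {f : ℕ → V → V'} {W : Set V} {s : ℕ}
    (h : EmbeddedCopies A B f W (s + 1)) : EmbedsAwayFrom A B (f s) W (copies f W s) where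
  inj x hx y hy e := (h.inj s (by omega) s (by omega) x hx y hy e).2
  rel x hx y hy := by rw [h.rel s (by omega) s (by omega) x hx y hy]; simp
  disj := by
    rintro x hx _ ⟨i, hi, y, hy, rfl⟩ e
    exact hi.ne (h.inj i (by omega) s (by omega) y hy x hx e).1
  unrel := by
    rintro x hx _ ⟨i, hi, y, hy, rfl⟩ e
    exact hi.ne' ((h.rel s (by omega) i (by omega) x hx y hy).1 e).1

lemma RegBound.copies {f : ℕ → V → V'} {W : Set V} {r s : ℕ} (hW : RegBound A W r)
    (h : EmbeddedCopies A B f W s) : RegBound B (copies f W s) (s * r) := by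
  induction s with
  | zero => rw [copies_zero]; exact .empty _
  | succ s ih =>
    rw [copies_succ, Nat.succ_mul, Nat.add_comm]
    exact hW.union (ih (h.mono subset_rfl (by omega))) h.embedsAwayFrom

lemma SphereHomology.copies {f : ℕ → V → V'} {W : Set V} {r s : ℕ} (hW : SphereHomology A W r)
    (h : EmbeddedCopies A B f W s) : SphereHomology B (copies f W s) (s * r) := by
  induction s with
  | zero => rw [copies_zero, Nat.zero_mul]; exact .empty
  | succ s ih =>
    rw [copies_succ, Nat.succ_mul, Nat.add_comm]
    exact hW.union (ih (h.mono subset_rfl (by omega))) h.embedsAwayFrom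

variable {K : Type*} [Field K] {N : ℕ} {G : SimpleGraph (Fin N)} {W : Set (Fin N)}

lemma RegBound.acyclic {r : ℕ} (h : RegBound G.Adj W r) :
    ∀ m, r < m → Acyclic K (IndepIn G W) m := by
  induction h with
  | empty r =>
    intro m hm z hz _
    have : z = 0 := by
      ext F
      by_contra hF
      obtain ⟨h1, h2⟩ := hz F hF
      have : F = ∅ := by simpa [IndepIn] using h1.1
      simp [this] at h2
      omega
    exact ⟨0, fun F hF => absurd rfl hF, by simp [this]⟩
  | @isolated W r x hA _ ih =>
    intro m hm
    by_cases hx : x ∈ W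
    · exact acyclic_of_isolated hx hA m
    · rw [Set.sdiff_singleton_eq_self hx] at ih
      exact ih m hm
  | step x _ _ ih1 ih2 =>
    intro m hm
    obtain ⟨m, rfl⟩ : ∃ s, m = s + 1 := ⟨m - 1, by omega⟩
    exact acyclic_step x (ih1 _ hm) (ih2 _ (by omega))

lemma TrivialHomology.acyclic (h : TrivialHomology G.Adj W) :
    ∀ m, Acyclic K (IndepIn G W) m := by
  induction h with
  | isolated x hx hA => exact acyclic_of_isolated hx hA
  | step x _ _ ih1 ih2 =>
    rintro (_ | m)
    · exact acyclic_zero_of_subset Set.sdiff_subset (ih1 0)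
    · exact acyclic_step x (ih1 _) (ih2 _)

lemma SphereHomology.not_acyclic {p : ℕ} (h : SphereHomology G.Adj W p) :
    ¬ Acyclic K (IndepIn G W) p := by
  induction h with
  | empty =>
    intro h
    have h0 : ∀ F : Finset (Fin N), IndepIn G ∅ F → F = ∅ := fun F hF => by
      simpa [IndepIn] using hF.1
    obtain ⟨u, hu, hbu⟩ := h (Pi.single ∅ 1) (by
      intro F hF
      obtain rfl : F = ∅ := by
        by_contra hne
        exact hF (Pi.single_eq_of_ne hne _)
      simp [IndepIn]) (by
      ext F
      simp [fullBoundary_apply, contractVertex_apply])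
    have : u = 0 := by
      ext F
      by_contra hF
      obtain ⟨h1, h2⟩ := hu F hF
      simp [h0 F h1] at h2
    have := congr_fun hbu ∅
    simp [‹u = 0›] at this
  | fold x _ h2 ih => exact not_acyclic_fold x ih (h2.acyclic _)
  | suspension x hx _ h2 ih => exact not_acyclic_suspension hx ih (h2.acyclic _)

lemma lt_card_of_not_acyclic {W : Finset (Fin N)} {m : ℕ} (hm : 0 < m)
    (h : ¬ Acyclic K (IndepIn G W) m) : m < W.card := by
  by_contra hW
  refine h fun z hz hbz => ?_
  by_cases hz0 : z = 0
  · exact ⟨0, fun F hF => absurd rfl hF, by simp [hz0]⟩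
  obtain ⟨F, hF⟩ : ∃ F, z F ≠ 0 := by
    by_contra hcon
    push Not at hcon
    exact hz0 (funext hcon)
  obtain ⟨⟨h1, h2⟩, h3⟩ := hz F hF
  have hFW : F = W := Finset.eq_of_subset_of_card_le (by exact_mod_cast h1) (by omega)
  subst hFW
  obtain ⟨x, hx⟩ := Finset.card_pos.1 (h3 ▸ hm)
  exact acyclic_of_isolated (K := K) (Finset.mem_coe.2 hx) (fun y hy => h2 x hx y hy) m z hz hbz

end Derivations

section Hochster

variable {K : Type*} [Field K] {N : ℕ}

lemma sum_bcoeff_mul (c : Finset (Fin N) → K) (G : Finset (Fin N)) :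
    ∑ F, bcoeff K F G * c F = fullBoundary c G := by
  have h1 : ∀ F, bcoeff K F G * c F =
      ∑ v, if v ∈ F ∧ F.erase v = G then insertSign K v F * c F else 0 := by
    intro F
    rw [bcoeff, Finset.sum_mul, ← Finset.sum_filter_add_sum_filter_not Finset.univ (· ∈ F)]
    rw [Finset.sum_eq_zero (s := Finset.univ.filter (¬ · ∈ F)), add_zero]
    · refine Finset.sum_congr (by simp) fun v hv => ?_
      simp [(Finset.mem_filter.1 hv).2, insertSign]
    · intro v hv
      simp [(Finset.mem_filter.1 hv).2]
  rw [Finset.sum_congr rfl fun F _ => h1 F, Finset.sum_comm, fullBoundary_apply, Finset.sum_apply]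
  refine Finset.sum_congr rfl fun v _ => ?_
  rw [contractVertex_apply]
  split_ifs with hv
  · refine Finset.sum_eq_zero fun F _ => if_neg ?_
    rintro ⟨-, rfl⟩
    simp at hv
  · rw [Finset.sum_eq_single (insert v G), if_pos ⟨by simp, by simp [hv]⟩,
      insertSign_insert_self]
    · rintro F - hF
      refine if_neg ?_
      rintro ⟨h, rfl⟩
      exact hF (Finset.insert_erase h).symm
    · simp

/-- The extension by zero of a chain on the `m`-element faces of `Δ`. -/
noncomputable def extendChain (Δ : Finset (Finset (Fin N))) (m : ℕ)
    (z : {F // F ∈ cfaces Δ m} → K) (F : Finset (Fin N)) : K :=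
  if h : F ∈ cfaces Δ m then z ⟨F, h⟩ else 0

lemma extendChain_isChainOn (Δ : Finset (Finset (Fin N))) (m : ℕ)
    (z : {F // F ∈ cfaces Δ m} → K) : IsChainOn (· ∈ Δ) m (extendChain Δ m z) := by
  intro F hF
  unfold extendChain at hF
  split_ifs at hF with h
  · simpa [cfaces] using h
  · exact absurd rfl hF

lemma extendChain_restrict {Δ : Finset (Finset (Fin N))} {m : ℕ} {c : Finset (Fin N) → K}
    (hc : IsChainOn (· ∈ Δ) m c) : extendChain Δ m (fun F => c F.1) = c := by
  ext F
  unfold extendChain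
  split_ifs with h
  · rfl
  · by_contra h0
    exact h (by simpa [cfaces] using hc F (Ne.symm h0))

lemma boundaryMap_apply_eq (Δ : Finset (Finset (Fin N))) (m : ℕ)
    (z : {F // F ∈ cfaces Δ (m + 1)} → K) (G : {G // G ∈ cfaces Δ m}) :
    boundaryMap K Δ m z G = fullBoundary (extendChain Δ (m + 1) z) G.1 := by
  rw [← sum_bcoeff_mul]
  simp only [boundaryMap, LinearMap.pi_apply, LinearMap.sum_apply, LinearMap.smul_apply,
    LinearMap.proj_apply, smul_eq_mul]
  rw [← Finset.sum_subset (Finset.subset_univ (cfaces Δ (m + 1))),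
    ← Finset.sum_coe_sort (cfaces Δ (m + 1))]
  · refine Finset.sum_congr rfl fun F _ => ?_
    rw [extendChain, dif_pos F.2]
  · intro F _ hF
    rw [extendChain, dif_neg hF, mul_zero]

lemma fullBoundary_isChainOn {S : Finset (Fin N) → Prop} (hS : ∀ F G, G ⊆ F → S F → S G) {m : ℕ}
    {c : Finset (Fin N) → K} (hc : IsChainOn S (m + 1) c) : IsChainOn S m (fullBoundary c) := by
  intro G hG
  rw [fullBoundary_apply, Finset.sum_apply] at hG
  obtain ⟨v, -, hv⟩ := Finset.exists_ne_zero_of_sum_ne_zero hG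
  rw [contractVertex_apply] at hv
  split_ifs at hv with hvG
  · exact absurd rfl hv
  obtain ⟨h1, h2⟩ := hc _ (right_ne_zero_of_mul hv)
  rw [Finset.card_insert_of_notMem hvG] at h2
  exact ⟨hS _ _ (Finset.subset_insert v G) h1, by omega⟩

lemma boundaryMap_eq_iff {Δ : Finset (Finset (Fin N))} (hΔ : ∀ F G, G ⊆ F → F ∈ Δ → G ∈ Δ) {m : ℕ}
    (z : {F // F ∈ cfaces Δ (m + 1)} → K) (y : {F // F ∈ cfaces Δ m} → K) :
    boundaryMap K Δ m z = y ↔ fullBoundary (extendChain Δ (m + 1) z) = extendChain Δ m y := by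
  constructor
  · rintro rfl
    rw [← extendChain_restrict (fullBoundary_isChainOn hΔ (extendChain_isChainOn Δ (m + 1) z))]
    congr 1
    ext G
    rw [boundaryMap_apply_eq]
  · intro h
    ext G
    rw [boundaryMap_apply_eq, h, extendChain, dif_pos G.2]

lemma reducedHomologyRank_eq_zero_iff {Δ : Finset (Finset (Fin N))}
    (hΔ : ∀ F G, G ⊆ F → F ∈ Δ → G ∈ Δ) (p : ℕ) :
    reducedHomologyRank K Δ (p : ℤ) = 0 ↔ Acyclic K (· ∈ Δ) (p + 1) := by
  rw [reducedHomologyRank, if_neg (by omega), if_pos (by omega), Int.toNat_natCast,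
    Module.finrank_zero_iff, Submodule.Quotient.subsingleton_iff,
    Submodule.comap_subtype_eq_top]
  have hzero : ∀ m, extendChain Δ m (0 : {F // F ∈ cfaces Δ m} → K) = 0 := fun m => by
    ext F; simp [extendChain]
  constructor
  · intro h z hz hbz
    obtain ⟨u, hu⟩ := h (x := fun F => z F.1) (by
      rw [LinearMap.mem_ker, boundaryMap_eq_iff hΔ, extendChain_restrict hz, hbz, hzero])
    refine ⟨_, extendChain_isChainOn Δ _ u, ?_⟩
    rw [(boundaryMap_eq_iff hΔ _ _).1 hu, extendChain_restrict hz]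
  · intro h z hz
    obtain ⟨u, hu, hbu⟩ := h _ (extendChain_isChainOn Δ _ z) (by
      rw [LinearMap.mem_ker, boundaryMap_eq_iff hΔ, hzero] at hz
      exact hz)
    exact ⟨fun F => u F.1, by rw [boundaryMap_eq_iff hΔ, extendChain_restrict hu, hbu]⟩

/-- The copy of `G` on `Fin (card V)` underlying `indComplex G`. -/
noncomputable def labelledGraph {V : Type*} [Fintype V] (G : SimpleGraph V) :
    SimpleGraph (Fin (Fintype.card V)) :=
  G.comap (Fintype.equivFin V).symm

lemma mem_indComplex_filter {V : Type*} [Fintype V] (G : SimpleGraph V)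
    (W F : Finset (Fin (Fintype.card V))) :
    F ∈ (indComplex G).filter (fun F => F ⊆ W) ↔ IndepIn (labelledGraph G) W F := by
  simp only [indComplex, Finset.mem_filter, Finset.mem_univ, true_and, IndepIn, labelledGraph,
    SimpleGraph.comap_adj, Finset.coe_subset]
  exact and_comm

lemma reducedHomologyRank_indComplex_eq_zero_iff {V : Type*} [Fintype V] (G : SimpleGraph V)
    (W : Finset (Fin (Fintype.card V))) (p : ℕ) :
    reducedHomologyRank K ((indComplex G).filter (fun F => F ⊆ W)) (p : ℤ) = 0 ↔
      Acyclic K (IndepIn (labelledGraph G) W) (p + 1) := by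
  rw [reducedHomologyRank_eq_zero_iff]
  · rw [show (· ∈ (indComplex G).filter (fun F => F ⊆ W)) = IndepIn (labelledGraph G) W from
      funext fun F => propext (mem_indComplex_filter G W F)]
  · intro F F' h hF
    rw [mem_indComplex_filter] at hF ⊢
    exact ⟨fun v hv => hF.1 (h hv), fun u hu v hv => hF.2 u (h hu) v (h hv)⟩

/-- The regularity of an edge ideal from matching recursive bounds. -/
lemma regEdgeIdeal_eq {V : Type*} [Fintype V] (G : SimpleGraph V) {r : ℕ} (hr : 0 < r)
    (hub : RegBound (labelledGraph G).Adj Set.univ r) {W : Set (Fin (Fintype.card V))}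
    (hlb : SphereHomology (labelledGraph G).Adj W r) : regEdgeIdeal K G = r + 1 := by
  classical
  obtain ⟨W, rfl⟩ : ∃ W' : Finset (Fin (Fintype.card V)), (W' : Set _) = W :=
    ⟨W.toFinset, by simp⟩
  have hna := hlb.not_acyclic (K := K)
  have hcard := lt_card_of_not_acyclic hr hna
  obtain ⟨q, rfl⟩ : ∃ q, r = q + 1 := ⟨r - 1, by omega⟩
  refine IsGreatest.csSup_eq ⟨⟨W.card - (q + 2), W.card, ?_, by omega⟩, ?_⟩
  · intro h
    rw [bettiNumber, Finset.sum_eq_zero_iff] at h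
    have := h W (by simp)
    rw [show (W.card : ℤ) - ((W.card - (q + 2) : ℕ) : ℤ) - 2 = (q : ℤ) by omega,
      reducedHomologyRank_indComplex_eq_zero_iff] at this
    exact hna this
  · rintro d ⟨i, j, hb, hd⟩
    by_contra hlt
    refine hb (Finset.sum_eq_zero fun U _ => ?_)
    rw [hd, show (d : ℤ) - 2 = ((d - 2 : ℕ) : ℤ) by omega,
      reducedHomologyRank_indComplex_eq_zero_iff]
    exact (hub.mono (Set.subset_univ _) le_rfl).acyclic _ (by omega)

end Hochster

section Prism

/-- Adjacency in the prism over an `m`-cycle, with vertices `(column, side)`, where columns are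
`0, …, m - 1` and sides are `0, 1`. -/
def PrismAdj (m : ℕ) (u v : ℕ × ℕ) : Prop :=
  (u.1 = v.1 ∧ u.2 + v.2 = 1) ∨
  (u.2 = v.2 ∧ (v.1 = u.1 + 1 ∨ u.1 = v.1 + 1 ∨ (u.1 = 0 ∧ v.1 + 1 = m) ∨ (v.1 = 0 ∧ u.1 + 1 = m)))

/-- The vertices in columns `lo, …, hi - 1`. -/
def ladder (lo hi : ℕ) : Set (ℕ × ℕ) := {v | lo ≤ v.1 ∧ v.1 < hi ∧ v.2 < 2}

/-- The ladder on columns `lo, …, hi - 1` with a pendant vertex on side `e` before the first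
column and a pendant vertex on side `e'` after the last column. -/
def pendantLadder (lo hi e e' : ℕ) : Set (ℕ × ℕ) :=
  {v | (lo ≤ v.1 ∧ v.1 < hi ∧ v.2 < 2) ∨ (v.1 + 1 = lo ∧ v.2 = e) ∨ (v.1 = hi ∧ v.2 = e')}

lemma regBound_ladder {m : ℕ} (j : ℕ) :
    ∀ lo, 1 ≤ lo → lo + 2 * j ≤ m → RegBound (PrismAdj m) (ladder lo (lo + 2 * j)) j := by
  induction j with
  | zero =>
    intro lo _ _
    refine (RegBound.empty 0).mono ?_ le_rfl
    rintro ⟨c, b⟩ h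
    simp only [ladder, Set.mem_ofPred_eq] at h
    omega
  | succ j ih =>
    intro lo h1 h2
    have ih := ih (lo + 2) (by omega) (by omega)
    refine .step (lo + 1, 0) (.step (lo + 1, 1) (.step (lo, 0) (.isolated (lo, 1) ?_
      (ih.mono ?_ (by omega))) (ih.mono ?_ le_rfl)) (.isolated (lo, 0) ?_ (ih.mono ?_ le_rfl)))
      (.isolated (lo, 1) ?_ (ih.mono ?_ le_rfl))
    all_goals
      rintro ⟨c, b⟩
      simp only [ladder, linkSet, PrismAdj, Set.mem_ofPred_eq, Set.mem_sdiff, Set.mem_singleton_iff,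
        Prod.mk.injEq, ne_eq]
      grind

lemma regBound_pendantLadder {m : ℕ} (j : ℕ) :
    ∀ lo e e', 2 ≤ lo → e < 2 → e' < 2 → (e + e' + j) % 2 = 1 → lo + 2 * j < m →
      RegBound (PrismAdj m) (pendantLadder lo (lo + 2 * j) e e') j := by
  induction j with
  | zero =>
    intro lo e e' _ _ _ _ _
    refine .isolated (lo - 1, e) ?_ (.isolated (lo, e') ?_ ((RegBound.empty 0).mono ?_ le_rfl))
    all_goals
      rintro ⟨c, b⟩
      simp only [pendantLadder, PrismAdj, Set.mem_ofPred_eq, Set.mem_sdiff, Set.mem_singleton_iff,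
        Prod.mk.injEq, Set.mem_empty_iff_false]
      grind
  | succ j ih =>
    intro lo e e' h1 he he' h h2
    have ih := ih (lo + 2) (1 - e) e' (by omega) (by omega) he' (by omega) (by omega)
    have hj : e ≠ e' → 0 < j := by omega
    clear h
    refine .step (lo, e) (.isolated (lo - 1, e) ?_ (.step (lo + 1, 1 - e) (.isolated (lo, 1 - e) ?_
      (.step (lo + 2, e) (.isolated (lo + 1, e) ?_ (ih.mono ?_ (by omega))) (ih.mono ?_ le_rfl)))
      (ih.mono ?_ le_rfl))) (ih.mono ?_ le_rfl)
    all_goals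
      clear ih
      rintro ⟨c, b⟩
      simp only [pendantLadder, linkSet, PrismAdj, Set.mem_ofPred_eq, Set.mem_sdiff,
        Set.mem_singleton_iff, Prod.mk.injEq, ne_eq]
      grind

lemma regBound_prism_even {k : ℕ} (hk : Even k) (h0 : 0 < k) :
    RegBound (PrismAdj (2 * k + 1)) (ladder 0 (2 * k + 1)) k := by
  obtain ⟨j, rfl⟩ : ∃ j, k = j + 1 := ⟨k - 1, by omega⟩
  rw [Nat.even_iff] at hk
  have h1 := regBound_ladder (m := 2 * (j + 1) + 1) (j + 1) 1 le_rfl (by omega)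
  have h2 := regBound_pendantLadder (m := 2 * (j + 1) + 1) j 2 0 0 le_rfl (by omega)
    (by omega) (by omega) (by omega)
  have h3 := regBound_pendantLadder (m := 2 * (j + 1) + 1) j 2 1 1 le_rfl (by omega)
    (by omega) (by omega) (by omega)
  refine .step (0, 0) (.step (0, 1) (h1.mono ?_ le_rfl) (h2.mono ?_ le_rfl)) (h3.mono ?_ le_rfl)
  all_goals
    rintro ⟨c, b⟩
    simp only [pendantLadder, ladder, linkSet, PrismAdj, Set.mem_ofPred_eq, Set.mem_sdiff,
      Set.mem_singleton_iff, Prod.mk.injEq, ne_eq]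
    grind

lemma regBound_prism (k : ℕ) :
    RegBound (PrismAdj (2 * k + 1)) (ladder 0 (2 * k + 1)) (k + 1) := by
  have h1 := regBound_ladder (m := 2 * k + 1) k 1 le_rfl (by omega)
  refine .step (0, 0) (.step (0, 1) (h1.mono ?_ (by omega)) (h1.mono ?_ le_rfl)) (h1.mono ?_ le_rfl)
  all_goals
    rintro ⟨c, b⟩
    simp only [ladder, linkSet, PrismAdj, Set.mem_ofPred_eq, Set.mem_sdiff,
      Set.mem_singleton_iff, Prod.mk.injEq, ne_eq]
    grind

/-- The rungs of the prism in the odd columns below `2 * j`. -/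
def oddRungs (j : ℕ) : Set (ℕ × ℕ) := {v | v.1 % 2 = 1 ∧ v.1 < 2 * j ∧ v.2 < 2}

lemma sphereHomology_oddRungs {m : ℕ} (j : ℕ) :
    2 * j < m → SphereHomology (PrismAdj m) (oddRungs j) j := by
  induction j with
  | zero =>
    intro _
    have : oddRungs 0 = ∅ := by
      ext v; simp [oddRungs]
    rw [this]
    exact .empty
  | succ j ih =>
    intro hj
    have hlink : linkSet (PrismAdj m) (oddRungs (j + 1)) (2 * j + 1, 0) = oddRungs j := by
      ext ⟨c, b⟩
      simp only [oddRungs, linkSet, PrismAdj, Set.mem_ofPred_eq, Prod.mk.injEq, ne_eq]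
      grind
    refine .suspension (2 * j + 1, 0) ?_ (hlink ▸ ih (by omega))
      (.isolated (2 * j + 1, 1) ?_ ?_)
    · simp only [oddRungs, Set.mem_ofPred_eq]; grind
    · simp only [oddRungs, Set.mem_ofPred_eq, Set.mem_sdiff, Set.mem_singleton_iff,
        Prod.mk.injEq]
      grind
    · rintro ⟨c, b⟩
      simp only [oddRungs, PrismAdj, Set.mem_ofPred_eq, Set.mem_sdiff, Set.mem_singleton_iff,
        Prod.mk.injEq]
      grind

lemma sphereHomology_pendantLadder {k : ℕ} (hk : Odd k) (j : ℕ) :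
    ∀ i e, i + j + 1 = k → e < 2 → (i + e) % 2 = 1 →
      SphereHomology (PrismAdj (2 * k + 1)) (pendantLadder (2 * i + 2) (2 * k) e 1) (j + 1) := by
  rw [Nat.odd_iff] at hk
  induction j with
  | zero =>
    intro i e hi he hie
    obtain rfl : e = 1 := by omega
    have hlink : linkSet (PrismAdj (2 * k + 1)) (pendantLadder (2 * i + 2) (2 * k) 1 1)
        (2 * k, 1) = ∅ := by
      rw [Set.eq_empty_iff_forall_notMem]
      rintro ⟨c, b⟩
      simp only [pendantLadder, linkSet, PrismAdj, Set.mem_ofPred_eq, Prod.mk.injEq, ne_eq]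
      grind
    refine .suspension (2 * k, 1) ?_ (hlink ▸ .empty) (.isolated (2 * i + 1, 1) ?_ ?_)
    · simp [pendantLadder]
    · simp only [pendantLadder, Set.mem_ofPred_eq, Set.mem_sdiff, Set.mem_singleton_iff,
        Prod.mk.injEq]
      grind
    · rintro ⟨c, b⟩
      simp only [pendantLadder, PrismAdj, Set.mem_ofPred_eq, Set.mem_sdiff, Set.mem_singleton_iff,
        Prod.mk.injEq]
      grind
  | succ j ih =>
    intro i e hi he hie
    have ih := ih (i + 1) (1 - e) (by omega) (by omega) (by omega)
    have hlink : linkSet (PrismAdj (2 * k + 1))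
        ((pendantLadder (2 * i + 2) (2 * k) e 1 \ {(2 * i + 2, 1 - e)}) \ {(2 * i + 3, e)})
        (2 * i + 1, e) = pendantLadder (2 * (i + 1) + 2) (2 * k) (1 - e) 1 := by
      clear ih hie hk
      ext ⟨c, b⟩
      simp only [pendantLadder, linkSet, PrismAdj, Set.mem_ofPred_eq, Set.mem_sdiff,
        Set.mem_singleton_iff, Prod.mk.injEq, ne_eq]
      grind
    refine .fold (2 * i + 2, 1 - e) (.fold (2 * i + 3, e)
      (.suspension (2 * i + 1, e) ?_ (hlink ▸ ih) (.isolated (2 * i + 2, e) ?_ ?_))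
      (.isolated (2 * i + 1, e) ?_ ?_)) (.isolated (2 * i + 1, e) ?_ ?_)
    all_goals
      clear ih hlink hie hk
      try rintro ⟨c, b⟩
      simp only [pendantLadder, linkSet, PrismAdj, Set.mem_ofPred_eq, Set.mem_sdiff,
        Set.mem_singleton_iff, Prod.mk.injEq, ne_eq, and_true, true_and]
      grind

/-- The prism over the `(2 * k + 1)`-cycle without the vertices `(2 * i, i % 2)` for `i ≤ j`. -/
def thinnedPrism (k j : ℕ) : Set (ℕ × ℕ) :=
  {v | v.1 ≤ 2 * k ∧ v.2 < 2 ∧ ¬ (v.1 % 2 = 0 ∧ v.1 ≤ 2 * j ∧ v.2 = v.1 / 2 % 2)}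

/-- The part of the thinned prism in the columns `2 * j, …, 2 * k`. -/
def thinnedTail (k j : ℕ) : Set (ℕ × ℕ) :=
  {v | v.1 ≤ 2 * k ∧ v.2 < 2 ∧ ¬ (v.1 % 2 = 0 ∧ v.2 = v.1 / 2 % 2) ∧ 2 * j ≤ v.1}

lemma trivialHomology_thinnedTail {k : ℕ} (hk : Odd k) (i : ℕ) :
    ∀ j, j + i = k → TrivialHomology (PrismAdj (2 * k + 1)) (thinnedTail k j) := by
  rw [Nat.odd_iff] at hk
  induction i with
  | zero =>
    rintro j hj
    refine .isolated (2 * j, 1 - j % 2) ?_ ?_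
    · simp only [thinnedTail, Set.mem_ofPred_eq]; grind
    · rintro ⟨c, b⟩
      simp only [thinnedTail, PrismAdj, Set.mem_ofPred_eq]
      grind
  | succ i ih =>
    intro j hj
    have hlink : linkSet (PrismAdj (2 * k + 1)) (thinnedTail k j \ {(2 * j + 1, j % 2)})
        (2 * j, 1 - j % 2) = thinnedTail k (j + 1) := by
      ext ⟨c, b⟩
      simp only [thinnedTail, linkSet, PrismAdj, Set.mem_ofPred_eq, Set.mem_sdiff,
        Set.mem_singleton_iff, Prod.mk.injEq, ne_eq]
      grind
    refine .step (2 * j + 1, j % 2) (.step (2 * j, 1 - j % 2)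
      (.isolated (2 * j + 1, 1 - j % 2) ?_ ?_) (hlink ▸ ih (j + 1) (by omega)))
      (.isolated (2 * j, 1 - j % 2) ?_ ?_)
    all_goals
      try rintro ⟨c, b⟩
      simp only [thinnedTail, linkSet, PrismAdj, Set.mem_ofPred_eq, Set.mem_sdiff,
        Set.mem_singleton_iff, Prod.mk.injEq, ne_eq]
      grind

lemma trivialHomology_thinnedPrism {k : ℕ} (hk : Odd k) (i : ℕ) :
    ∀ j, j + i = k → TrivialHomology (PrismAdj (2 * k + 1)) (thinnedPrism k j) := by
  induction i with
  | zero =>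
    rintro j hj
    have : thinnedPrism k j = thinnedTail k 0 := by
      ext ⟨c, b⟩
      simp only [thinnedPrism, thinnedTail, Set.mem_ofPred_eq]
      grind
    rw [this]
    exact trivialHomology_thinnedTail hk k 0 (by omega)
  | succ i ih =>
    intro j hj
    have hdel : thinnedPrism k j \ {(2 * j + 2, (j + 1) % 2)} = thinnedPrism k (j + 1) := by
      ext ⟨c, b⟩
      simp only [thinnedPrism, Set.mem_ofPred_eq, Set.mem_sdiff, Set.mem_singleton_iff,
        Prod.mk.injEq]
      grind
    refine .step (2 * j + 2, (j + 1) % 2) (hdel ▸ ih (j + 1) (by omega))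
      (.isolated (2 * j + 1, j % 2) ?_ ?_)
    all_goals
      try rintro ⟨c, b⟩
      simp only [thinnedPrism, linkSet, PrismAdj, Set.mem_ofPred_eq, Prod.mk.injEq, ne_eq]
      grind

lemma sphereHomology_prism_odd {k : ℕ} (hk : Odd k) :
    SphereHomology (PrismAdj (2 * k + 1)) (ladder 0 (2 * k + 1)) (k + 1) := by
  obtain ⟨j, rfl⟩ : ∃ j, k = j + 1 := ⟨k - 1, by have := hk.pos; omega⟩
  have h1 := sphereHomology_pendantLadder hk j 0 1 (by omega) (by omega) (by omega)
  have h2 := trivialHomology_thinnedPrism hk (j + 1) 0 (by omega)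
  refine .suspension (0, 0) ?_ ?_ ?_
  · simp [ladder]
  · convert h1 using 1
    ext ⟨c, b⟩
    simp only [pendantLadder, ladder, linkSet, PrismAdj, Set.mem_ofPred_eq, Prod.mk.injEq, ne_eq]
    grind
  · convert h2 using 1
    ext ⟨c, b⟩
    simp only [thinnedPrism, ladder, Set.mem_ofPred_eq, Set.mem_sdiff, Set.mem_singleton_iff,
      Prod.mk.injEq]
    grind

end Prism

section Circulant

/-- The vertex `i + c * a + b * n` of `C_{2n}(a, n)`, in column `c` and on side `b` of its `i`-th
prism. -/
def prismPoint (n a i : ℕ) (v : ℕ × ℕ) : ZMod (2 * n) :=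
  ((i + v.1 * a + v.2 * n : ℕ) : ZMod (2 * n))

lemma prismPoint_inj {m s a i j : ℕ} {u v : ℕ × ℕ} (hm : Odd m) (ha : a.Coprime m)
    (hi : i < s) (hj : j < s) (hu : u ∈ ladder 0 m) (hv : v ∈ ladder 0 m)
    (h : prismPoint (m * s) (2 * s * a) i u = prismPoint (m * s) (2 * s * a) j v) :
    i = j ∧ u = v := by
  obtain ⟨c, b⟩ := u
  obtain ⟨d, e⟩ := v
  obtain ⟨-, hc, hb⟩ := hu
  obtain ⟨-, hd, he⟩ := hv
  simp only at hc hb hd he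
  rw [prismPoint, prismPoint, ZMod.natCast_eq_natCast_iff] at h
  simp only at h
  have hij : i = j := by
    have h1 := h.of_dvd (⟨2 * m, by ring⟩ : s ∣ 2 * (m * s))
    have h2 : ∀ i c b : ℕ, i + c * (2 * s * a) + b * (m * s) ≡ i [MOD s] := fun i c b => by
      rw [show i + c * (2 * s * a) + b * (m * s) = i + s * (c * (2 * a) + b * m) by ring]
      simp [Nat.ModEq]
    exact (((h2 i c b).symm.trans h1).trans (h2 j d e)).eq_of_lt_of_lt hi hj
  subst hij
  have hs : s ≠ 0 := by omega
  rw [add_assoc, add_assoc] at h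
  replace h := h.add_left_cancel' i
  have h3 : c * (2 * a) + b * m ≡ d * (2 * a) + e * m [MOD 2 * m] := by
    refine Nat.ModEq.mul_left_cancel' hs ?_
    convert h using 1 <;> ring
  have hbe : b = e := by
    have h1 := h3.of_dvd (⟨m, rfl⟩ : 2 ∣ 2 * m)
    obtain ⟨k, rfl⟩ := hm
    have h2 : ∀ c b : ℕ, c * (2 * a) + b * (2 * k + 1) ≡ b [MOD 2] := fun c b => by
      rw [show c * (2 * a) + b * (2 * k + 1) = b + 2 * (c * a + b * k) by ring]
      simp [Nat.ModEq]
    exact (((h2 c b).symm.trans h1).trans (h2 d e)).eq_of_lt_of_lt hb he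
  subst hbe
  have h4 : c * a ≡ d * a [MOD m] := by
    refine Nat.ModEq.mul_left_cancel' two_ne_zero ?_
    convert h3.add_right_cancel' _ using 1 <;> ring
  have h5 : c ≡ d [MOD m] := Nat.ModEq.cancel_right_of_coprime ha.symm h4
  exact ⟨rfl, by rw [h5.eq_of_lt_of_lt hc hd]⟩

lemma copies_prismPoint {m s a : ℕ} [NeZero (m * s)] (hm : Odd m) (ha : a.Coprime m) :
    copies (prismPoint (m * s) (2 * s * a)) (ladder 0 m) s = Set.univ := by
  let g : Fin s × Fin m × Fin 2 → ZMod (2 * (m * s)) :=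
    fun p => prismPoint (m * s) (2 * s * a) p.1 (p.2.1, p.2.2)
  have hg : Function.Injective g := by
    rintro ⟨i, c, b⟩ ⟨j, d, e⟩ h
    have := prismPoint_inj hm ha i.2 j.2 ⟨Nat.zero_le _, c.2, b.2⟩ ⟨Nat.zero_le _, d.2, e.2⟩ h
    simpa [Fin.ext_iff] using this
  have hg' : Function.Bijective g := by
    rw [Fintype.bijective_iff_injective_and_card]
    refine ⟨hg, ?_⟩
    simp only [Fintype.card_prod, Fintype.card_fin, ZMod.card]
    ring
  refine Set.eq_univ_of_forall fun y => ?_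
  obtain ⟨⟨i, c, b⟩, rfl⟩ := hg'.2 y
  exact ⟨i, i.2, (c, b), ⟨Nat.zero_le _, c.2, b.2⟩, rfl⟩

/-- The column following column `c` in the prism over an `m`-cycle. -/
def nextColumn (m c : ℕ) : ℕ := if c + 1 = m then 0 else c + 1

lemma prismPoint_add_step {m s a i : ℕ} (c b : ℕ) :
    prismPoint (m * s) (2 * s * a) i (c, b) + ((2 * s * a : ℕ) : ZMod (2 * (m * s))) =
      prismPoint (m * s) (2 * s * a) i (nextColumn m c, b) := by
  rw [prismPoint, prismPoint, ← Nat.cast_add, ZMod.natCast_eq_natCast_iff]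
  simp only [nextColumn]
  split_ifs with h
  · subst h
    rw [show i + c * (2 * s * a) + b * ((c + 1) * s) + 2 * s * a =
      i + 0 * (2 * s * a) + b * ((c + 1) * s) + 2 * ((c + 1) * s) * a by ring]
    simp [Nat.ModEq]
  · exact congrArg (· % _) (by ring)

lemma prismPoint_add_half {n a i : ℕ} (c : ℕ) {b : ℕ} (hb : b < 2) :
    prismPoint n a i (c, b) + (n : ZMod (2 * n)) = prismPoint n a i (c, 1 - b) := by
  rw [prismPoint, prismPoint, ← Nat.cast_add, ZMod.natCast_eq_natCast_iff]
  simp only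
  interval_cases b
  · simp [Nat.ModEq]
  · rw [show i + c * a + 1 * n + n = i + c * a + (1 - 1) * n + 2 * n by ring_nf]
    simp [Nat.ModEq]

lemma embeddedCopies_prismPoint {m s a : ℕ} (hm : Odd m) (hm1 : m ≠ 1) (ha : a.Coprime m) :
    EmbeddedCopies (PrismAdj m) (circulant (2 * (m * s)) {2 * s * a, m * s}).Adj
      (prismPoint (m * s) (2 * s * a)) (ladder 0 m) s where
  inj i hi j hj u hu v hv h := prismPoint_inj hm ha hi hj hu hv h
  rel i hi j hj u hu v hv := by
    have hiff : ∀ {i j u v}, i < s → j < s → u ∈ ladder 0 m → v ∈ ladder 0 m →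
        (prismPoint (m * s) (2 * s * a) i u = prismPoint (m * s) (2 * s * a) j v ↔
          i = j ∧ u = v) := fun hi hj hu hv =>
      ⟨prismPoint_inj hm ha hi hj hu hv, by rintro ⟨rfl, rfl⟩; rfl⟩
    obtain ⟨c, b⟩ := u
    obtain ⟨d, e⟩ := v
    have hnext : ∀ {c b}, (c, b) ∈ ladder 0 m → (nextColumn m c, b) ∈ ladder 0 m := by
      intro c b
      simp only [ladder, nextColumn, Set.mem_ofPred_eq]
      grind
    have hflip : ∀ {c b}, (c, b) ∈ ladder 0 m → (c, 1 - b) ∈ ladder 0 m := by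
      intro c b
      simp only [ladder, Set.mem_ofPred_eq]
      grind
    simp only [circulant, SimpleGraph.fromRel_adj, Set.mem_insert_iff, Set.mem_singleton_iff,
      exists_eq_or_imp, exists_eq_left, sub_eq_iff_eq_add', ne_eq]
    rw [prismPoint_add_step, prismPoint_add_step, prismPoint_add_half _ hu.2.2,
      prismPoint_add_half _ hv.2.2, hiff hi hj hu hv, hiff hj hi hv (hnext hu),
      hiff hj hi hv (hflip hu), hiff hi hj hu (hnext hv), hiff hi hj hu (hflip hv)]
    simp only [ladder, Set.mem_ofPred_eq] at hu hv
    simp only [PrismAdj, nextColumn, Prod.mk.injEq]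
    grind

lemma EmbeddedCopies.labelledGraph {V V' : Type*} [Fintype V'] {A : V → V → Prop}
    {G : SimpleGraph V'} {f : ℕ → V → V'} {W : Set V} {s : ℕ} (h : EmbeddedCopies A G.Adj f W s) :
    EmbeddedCopies A (labelledGraph G).Adj (fun i v => Fintype.equivFin V' (f i v)) W s where
  inj i hi j hj x hx y hy hxy := h.inj i hi j hj x hx y hy ((Fintype.equivFin V').injective hxy)
  rel i hi j hj x hx y hy := by
    rw [← h.rel i hi j hj x hx y hy]
    simp [_root_.labelledGraph]

lemma regEdgeIdeal_eq_of_copies {K V V' : Type*} [Field K] [Fintype V'] {A : V → V → Prop}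
    {G : SimpleGraph V'} {f : ℕ → V → V'} {W W' : Set V} {r s : ℕ} (hr : 0 < r) (hs : 0 < s)
    (h : EmbeddedCopies A G.Adj f W s) (hf : copies f W s = Set.univ) (hub : RegBound A W r)
    (hW : W' ⊆ W) (hlb : SphereHomology A W' r) : regEdgeIdeal K G = s * r + 1 := by
  have hcopies : copies (fun i v => Fintype.equivFin V' (f i v)) W s = Set.univ := by
    refine Set.eq_univ_of_forall fun y => ?_
    obtain ⟨i, hi, x, hx, hxy⟩ := hf.symm ▸ Set.mem_univ ((Fintype.equivFin V').symm y)
    exact ⟨i, hi, x, hx, by simp [hxy]⟩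
  have hG := h.labelledGraph
  exact regEdgeIdeal_eq G (Nat.mul_pos hs hr) (hcopies ▸ hub.copies hG)
    (hlb.copies (hG.mono hW le_rfl))

lemma regEdgeIdeal_circulant {K : Type*} [Field K] {k s a : ℕ} [NeZero ((2 * k + 1) * s)]
    [Fintype (ZMod (2 * ((2 * k + 1) * s)))] (hk : 0 < k) (ha : a.Coprime (2 * k + 1)) :
    regEdgeIdeal K (circulant (2 * ((2 * k + 1) * s)) {2 * s * a, (2 * k + 1) * s}) =
      s * (if Even k then k else k + 1) + 1 := by
  have hm : Odd (2 * k + 1) := ⟨k, rfl⟩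
  have hs : 0 < s := Nat.pos_of_mul_pos_left (NeZero.pos ((2 * k + 1) * s))
  have hG := embeddedCopies_prismPoint (s := s) hm (by omega) ha
  split_ifs with h
  · refine regEdgeIdeal_eq_of_copies hk hs hG (copies_prismPoint hm ha) (regBound_prism_even h hk)
      ?_ (sphereHomology_oddRungs k (Nat.lt_succ_self _))
    rintro ⟨c, b⟩ ⟨-, h2, h3⟩
    exact ⟨Nat.zero_le _, Nat.lt_succ_of_lt h2, h3⟩
  · exact regEdgeIdeal_eq_of_copies k.succ_pos hs hG (copies_prismPoint hm ha) (regBound_prism k)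
      subset_rfl (sphereHomology_prism_odd (Nat.not_even_iff_odd.1 h))

end Circulant

/-- **Theorem 4.7(b).**
Let `1 ≤ a < n` and `t = gcd(2n, a)`, and suppose `2n/t` is odd, say
`2n/t = 2k + 1`.  Then the edge ideal of the cubic circulant graph
`C_{2n}(a, n)` satisfies `reg(I(C_{2n}(a, n))) = kt/2 + 1` if `k` is even,
and `reg(I(C_{2n}(a, n))) = (k+1)t/2 + 1` if `k` is odd. -/
theorem regularity_cubic_circulant_odd_case
    (K : Type*) [Field K] (n a : ℕ) [NeZero n]
    (ha1 : 1 ≤ a) (ha2 : a < n)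
    (t : ℕ) (ht : t = Nat.gcd (2 * n) a) (hodd : Odd (2 * n / t)) :
    ∀ k : ℕ, 2 * n / t = 2 * k + 1 →
      (Even k → regEdgeIdeal K (circulant (2 * n) {a, n}) = k * t / 2 + 1) ∧
      (Odd k → regEdgeIdeal K (circulant (2 * n) {a, n}) = (k + 1) * t / 2 + 1) := by
  intro k hk
  have htpos : 0 < t := ht ▸ Nat.gcd_pos_of_pos_right _ ha1
  have htn : 2 * n = (2 * k + 1) * t := by
    rw [← hk, Nat.div_mul_cancel (ht ▸ Nat.gcd_dvd_left _ _)]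
  have hta : t ∣ a := ht ▸ Nat.gcd_dvd_right _ _
  obtain ⟨s, rfl⟩ : ∃ s, t = 2 * s := by
    have h : 2 ∣ (2 * k + 1) * t := ⟨n, htn.symm⟩
    exact (Nat.Coprime.dvd_mul_left (by simp)).1 h
  obtain ⟨a, rfl⟩ := hta
  obtain rfl : n = (2 * k + 1) * s := by linarith
  have ha : a.Coprime (2 * k + 1) := by
    rw [show 2 * ((2 * k + 1) * s) = 2 * s * (2 * k + 1) by ring, Nat.gcd_mul_left] at ht
    exact Nat.coprime_comm.1 (Nat.eq_of_mul_eq_mul_left htpos (by omega))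
  have hk0 : 0 < k := by
    rcases Nat.eq_zero_or_pos k with rfl | h
    · nlinarith [Nat.pos_of_mul_pos_left ha1]
    · exact h
  refine ⟨fun h => ?_, fun h => ?_⟩
  · rw [regEdgeIdeal_circulant hk0 ha, if_pos h, Nat.mul_left_comm,
      Nat.mul_div_cancel_left _ two_pos, mul_comm]
  · rw [regEdgeIdeal_circulant hk0 ha, if_neg (Nat.not_even_iff_odd.2 h), Nat.mul_left_comm,
      Nat.mul_div_cancel_left _ two_pos, mul_comm]
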